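/- arXiv:2512.06604 — 2 statements merged into one kernel-verified Lean document; each statement's English description precedes it below -/
import Mathlib

section
/- Let I and J be finite interpretations (interpretations with finite domains), d ∈ Δ^I and e ∈ Δ^J. If (I,d) ≡_{ALCι_G} (J,e), then (I,d) ∼_{ALCι_G} (J,e); that is, there exists an ALCι_G bisimulation Z between I and J with (d,e) ∈ Z. (This is the instance of the paper's Theorem 3(2) for finite, hence ω-saturated, interpretations.) -/
universe u v

namespace DL

/-- ALCι concepts, with atomic concept names and role names both drawn from
the countably infinite (and disjoint, being distinct sorts) sets `ℕ`. -/
inductive Concept : Type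
  | atom : ℕ → Concept
  | neg : Concept → Concept
  | conj : Concept → Concept → Concept
  | ex : ℕ → Concept → Concept
  | iotaL : Concept → Concept
  | iotaG : Concept → Concept → Concept
  deriving DecidableEq

/-- An interpretation with (nonempty) domain `D`. -/
structure Interp (D : Type u) where
  atomI : ℕ → Set D
  roleI : ℕ → Set (D × D)

/-- The extension `C^I` of a concept `C` in the interpretation `I`. -/
def Interp.sem {D : Type u} (I : Interp D) : Concept → Set D
  | .atom A => I.atomI A
  | .neg C => (I.sem C)ᶜ
  | .conj C D' => I.sem C ∩ I.sem D'
  | .ex r C => {d | ∃ e, (d, e) ∈ I.roleI r ∧ e ∈ I.sem C}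
  | .iotaL C => {d | I.sem C = {d}}
  | .iotaG C D' => {_d | ∃ e, I.sem C = {e} ∧ e ∈ I.sem D'}

/-- Concepts not using the global definite description constructor `ιC.D`,
i.e. ALCι_L concepts. -/
def Concept.noG : Concept → Prop
  | .atom _ => True
  | .neg C => C.noG
  | .conj C D => C.noG ∧ D.noG
  | .ex _ C => C.noG
  | .iotaL C => C.noG
  | .iotaG _ _ => False

/-- Concepts not using the local definite description constructor `{ιC}`,
i.e. ALCι_G concepts. -/
def Concept.noL : Concept → Prop
  | .atom _ => True
  | .neg C => C.noL
  | .conj C D => C.noL ∧ D.noL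
  | .ex _ C => C.noL
  | .iotaL _ => False
  | .iotaG C D => C.noL ∧ D.noL

/-- ALC concepts: neither local nor global definite descriptions. -/
def Concept.isALC (C : Concept) : Prop := C.noG ∧ C.noL

/-- Condition (Atom) for a relation `Z ⊆ Δ^I × Δ^J`. -/
def AtomCond {D : Type u} {E : Type v} (I : Interp D) (J : Interp E) (Z : Set (D × E)) : Prop :=
  ∀ p ∈ Z, ∀ A : ℕ, p.1 ∈ I.atomI A ↔ p.2 ∈ J.atomI A

/-- Condition (Forth). -/
def ForthCond {D : Type u} {E : Type v} (I : Interp D) (J : Interp E) (Z : Set (D × E)) : Prop :=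
  ∀ p ∈ Z, ∀ r : ℕ, ∀ d' : D, (p.1, d') ∈ I.roleI r →
    ∃ e' : E, (p.2, e') ∈ J.roleI r ∧ (d', e') ∈ Z

/-- Condition (Back). -/
def BackCond {D : Type u} {E : Type v} (I : Interp D) (J : Interp E) (Z : Set (D × E)) : Prop :=
  ∀ p ∈ Z, ∀ r : ℕ, ∀ e' : E, (p.2, e') ∈ J.roleI r →
    ∃ d' : D, (p.1, d') ∈ I.roleI r ∧ (d', e') ∈ Z

/-- `Names(Δ', I)`: the set of ALC concepts whose extension in `I` is a
singleton `{d}` with `d ∈ Δ'`. -/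
def Names {D : Type u} (Δ' : Set D) (I : Interp D) : Set Concept :=
  {C | C.isALC ∧ ∃ d ∈ Δ', I.sem C = {d}}

/-- The domain of a relation. -/
def Dom {D : Type u} {E : Type v} (Z : Set (D × E)) : Set D := {d | ∃ e, (d, e) ∈ Z}

/-- The range of a relation. -/
def Rng {D : Type u} {E : Type v} (Z : Set (D × E)) : Set E := {e | ∃ d, (d, e) ∈ Z}

/-- ALCι_L bisimulations between `I` and `J`. -/
def IsBisimL {D : Type u} {E : Type v} (I : Interp D) (J : Interp E) (Z : Set (D × E)) : Prop :=
  Z = ∅ ∨ (AtomCond I J Z ∧ ForthCond I J Z ∧ BackCond I J Z ∧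
    Names (Dom Z) I = Names (Rng Z) J)

/-- ALCι_G bisimulations between `I` and `J`. -/
def IsBisimG {D : Type u} {E : Type v} (I : Interp D) (J : Interp E) (Z : Set (D × E)) : Prop :=
  Z = ∅ ∨ (AtomCond I J Z ∧ ForthCond I J Z ∧ BackCond I J Z ∧
    Names (Set.univ : Set D) I = Names (Set.univ : Set E) J)

/-- ALC bisimulations between `I` and `J`. -/
def IsBisimALC {D : Type u} {E : Type v} (I : Interp D) (J : Interp E) (Z : Set (D × E)) : Prop :=
  AtomCond I J Z ∧ ForthCond I J Z ∧ BackCond I J Z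

/-- The maximal ALC bisimulation between `I` and `J`: the union of all ALC
bisimulations between them. -/
def maxBisimALC {D : Type u} {E : Type v} (I : Interp D) (J : Interp E) : Set (D × E) :=
  ⋃₀ {Z | IsBisimALC I J Z}

/-- `NamedInd(Δ', I)`: the named individuals of `Δ'`. -/
def NamedInd {D : Type u} (Δ' : Set D) (I : Interp D) : Set D :=
  {d ∈ Δ' | ∃ C ∈ Names Δ' I, d ∈ I.sem C}

/-- A relation `Z` is total over `X × Y`. -/
def TotalOver {D : Type u} {E : Type v} (Z : Set (D × E)) (X : Set D) (Y : Set E) : Prop :=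
  (∀ x ∈ X, ∃ y ∈ Y, (x, y) ∈ Z) ∧ (∀ y ∈ Y, ∃ x ∈ X, (x, y) ∈ Z)

/-- `x` and `y` satisfy the same ALCι_G concepts. -/
def EquivG {D : Type u} {E : Type v} (I : Interp D) (J : Interp E) (x : D) (y : E) : Prop :=
  ∀ C : Concept, C.noL → (x ∈ I.sem C ↔ y ∈ J.sem C)

theorem EquivG.symm {D : Type u} {E : Type v} {I : Interp D} {J : Interp E} {x : D} {y : E}
    (h : EquivG I J x y) : EquivG J I y x :=
  fun C hC => (h C hC).symm

/-- A concept true at `x` and false at `y`, for inequivalent `x` and `y`. -/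
theorem exists_separating_concept {D : Type u} {E : Type v} {I : Interp D} {J : Interp E}
    {x : D} {y : E} (h : ¬ EquivG I J x y) :
    ∃ C : Concept, C.noL ∧ x ∈ I.sem C ∧ y ∉ J.sem C := by
  simp only [EquivG, not_forall] at h
  obtain ⟨C, hC, hne⟩ := h
  by_cases hx : x ∈ I.sem C
  · exact ⟨C, hC, hx, fun hy => hne (iff_of_true hx hy)⟩
  · exact ⟨.neg C, hC, hx, fun hy => hne (iff_of_false hx hy)⟩

/-- A single concept true at `x` and false at all members of a finite set inequivalent to `x`. -/
theorem exists_separating_concept_of_finite {D : Type u} {E : Type v} (I : Interp D)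
    (J : Interp E) (x : D) {s : Set E} (hs : s.Finite) :
    ∃ C : Concept, C.noL ∧ x ∈ I.sem C ∧ ∀ y ∈ s, ¬ EquivG I J x y → y ∉ J.sem C := by
  induction s, hs using Set.Finite.induction_on with
  | empty =>
    refine ⟨.neg (.conj (.atom 0) (.neg (.atom 0))), ⟨trivial, trivial⟩, ?_, by simp⟩
    simp [Interp.sem]
  | @insert a s _ _ ih =>
    obtain ⟨C, hC, hx, hsep⟩ := ih
    by_cases ha : EquivG I J x a
    · refine ⟨C, hC, hx, ?_⟩
      rintro y (rfl | hy) hne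
      · exact absurd ha hne
      · exact hsep y hy hne
    · obtain ⟨C', hC', hx', ha'⟩ := exists_separating_concept ha
      refine ⟨.conj C' C, ⟨hC', hC⟩, ⟨hx', hx⟩, ?_⟩
      rintro y (rfl | hy) hne hmem
      · exact ha' hmem.1
      · exact hsep y hy hne hmem.2

theorem EquivG.exists_successor {D : Type u} {E : Type v} [Finite E] {I : Interp D}
    {J : Interp E} {x x' : D} {y : E} (h : EquivG I J x y) {r : ℕ} (hr : (x, x') ∈ I.roleI r) :
    ∃ y', (y, y') ∈ J.roleI r ∧ EquivG I J x' y' := by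
  obtain ⟨C, hC, hx', hsep⟩ :=
    exists_separating_concept_of_finite I J x' (Set.finite_univ (α := E))
  obtain ⟨y', hy', hmem⟩ := (h (.ex r C) hC).1 ⟨x', hr, hx'⟩
  exact ⟨y', hy', by_contra fun hne => hsep y' trivial hne hmem⟩

/-- The concept `ιC.C` expresses that `C` is a name. -/
theorem mem_names_univ_iff {D : Type u} {I : Interp D} (d : D) {C : Concept} :
    C ∈ Names Set.univ I ↔ C.isALC ∧ d ∈ I.sem (.iotaG C C) := by
  simp only [Names, Interp.sem, Set.mem_ofPred_eq, Set.mem_univ, true_and]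
  refine and_congr_right fun _ => exists_congr fun e => ?_
  exact ⟨fun h => ⟨h, h ▸ rfl⟩, And.left⟩

theorem EquivG.names_eq {D : Type u} {E : Type v} {I : Interp D} {J : Interp E} {d : D} {e : E}
    (h : EquivG I J d e) : Names (Set.univ : Set D) I = Names (Set.univ : Set E) J := by
  ext C
  rw [mem_names_univ_iff d, mem_names_univ_iff e]
  exact and_congr_right fun hC => h (.iotaG C C) ⟨hC.2, hC.2⟩

/-- for finite interpretations, ALCι_G equivalence implies
ALCι_G bisimilarity: if `d` and `e` satisfy the same ALCι_G concepts, then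
there is an ALCι_G bisimulation `Z` between `I` and `J` with `(d,e) ∈ Z`. -/
theorem stmt5 {D : Type u} {E : Type v} [Nonempty D] [Nonempty E]
    [Finite D] [Finite E]
    (I : Interp D) (J : Interp E) (d : D) (e : E)
    (h : ∀ C : Concept, C.noL → (d ∈ I.sem C ↔ e ∈ J.sem C)) :
    ∃ Z : Set (D × E), IsBisimG I J Z ∧ (d, e) ∈ Z := by
  refine ⟨{p | EquivG I J p.1 p.2}, Or.inr ⟨?_, ?_, ?_, EquivG.names_eq h⟩, h⟩
  · exact fun p hp A => hp (.atom A) trivial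
  · exact fun p hp r d' hr => EquivG.exists_successor hp hr
  · intro p hp r e' hr
    obtain ⟨d', hd', he⟩ := EquivG.exists_successor (EquivG.symm hp) hr
    exact ⟨d', hd', he.symm⟩

end DL
end

section
/- Let C be an ALC concept and T a finite set of pairs (D,E) of ALC concepts (a TBox of concept inclusions D ⊑ E). For each (D,E) ∈ T, let A_{D⊑E} be a fresh atomic concept name, the fresh names pairwise distinct and not occurring in C or in any concept of T. Define the ALCι_G concept C'' := C ⊓ ⨅_{(D,E)∈T} ((¬D ⊔ E) ⊓ A_{D⊑E} ⊓ (ι(¬(¬D ⊔ E) ⊔ A_{D⊑E}).⊤)). Then C'' is satisfiable if and only if C is satisfiable with respect to T, i.e., there is an interpretation I with C^I ≠ ∅ and D^I ⊆ E^I for every (D,E) ∈ T. -/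
universe u v

namespace DL

/-- `C ⊔ D := ¬(¬C ⊓ ¬D)`. -/
def disj (C D : Concept) : Concept := .neg (.conj (.neg C) (.neg D))

/-- `⊤ := ¬(A ⊓ ¬A)` for a fixed atomic concept name `A` (its extension is the
whole domain in every interpretation). -/
def top (A₀ : ℕ) : Concept := .neg (.conj (.atom A₀) (.neg (.atom A₀)))

/-- `⨅`: the conjunction of a finite family of concepts. -/
def bigConj : List Concept → Concept
  | [] => top 0
  | C :: l => .conj C (bigConj l)

/-- The atomic concept names occurring in a concept. -/
def conceptNames : Concept → Finset ℕ
  | .atom A => {A}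
  | .neg C => conceptNames C
  | .conj C D => conceptNames C ∪ conceptNames D
  | .ex _ C => conceptNames C
  | .iotaL C => conceptNames C
  | .iotaG C D => conceptNames C ∪ conceptNames D

/-- The extension of a concept depends only on the roles and on the atomic names occurring in it. -/
theorem Interp.sem_congr {D : Type u} {I J : Interp D} (hr : I.roleI = J.roleI) (C : Concept)
    (h : ∀ a ∈ conceptNames C, I.atomI a = J.atomI a) : I.sem C = J.sem C := by
  induction C with
  | atom a => exact h a (by simp [conceptNames])
  | neg C ih => simp only [Interp.sem, ih h]
  | conj C E ihC ihE =>
    simp only [Interp.sem, ihC fun a ha => h a (Finset.mem_union_left _ ha),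
      ihE fun a ha => h a (Finset.mem_union_right _ ha)]
  | ex r C ih => simp only [Interp.sem, ih h, hr]
  | iotaL C ih => simp only [Interp.sem, ih h]
  | iotaG C E ihC ihE =>
    simp only [Interp.sem, ihC fun a ha => h a (Finset.mem_union_left _ ha),
      ihE fun a ha => h a (Finset.mem_union_right _ ha)]

theorem Interp.sem_disj {D : Type u} (I : Interp D) (C E : Concept) :
    I.sem (disj C E) = I.sem C ∪ I.sem E := by
  simp [disj, Interp.sem, Set.compl_inter]

theorem Interp.sem_top {D : Type u} (I : Interp D) (a : ℕ) : I.sem (top a) = Set.univ := by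
  simp [top, Interp.sem]

theorem Interp.mem_sem_bigConj {D : Type u} (I : Interp D) (l : List Concept) (d : D) :
    d ∈ I.sem (bigConj l) ↔ ∀ C ∈ l, d ∈ I.sem C := by
  induction l with
  | nil => simp [bigConj, Interp.sem_top]
  | cons C l ih => simp [bigConj, Interp.sem, ih]

/-- With `F` the concept `¬P ⊔ Q`, a point lies in `F ⊓ a ⊓ ι(¬F ⊔ a).⊤` iff `P ⊑ Q` holds globally
and `a` names exactly that point. -/
theorem Interp.mem_sem_inclusion_iff {D : Type u} (I : Interp D) (P Q : Concept) (a a₀ : ℕ)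
    (d : D) :
    d ∈ I.sem (.conj (.conj (disj (.neg P) Q) (.atom a))
        (.iotaG (disj (.neg (disj (.neg P) Q)) (.atom a)) (top a₀))) ↔
      I.sem P ⊆ I.sem Q ∧ I.atomI a = {d} := by
  simp only [Interp.sem, Interp.sem_disj, Interp.sem_top]
  constructor
  · rintro ⟨⟨hF, ha⟩, e, he, -⟩
    obtain rfl : d = e := by
      have : d ∈ ({e} : Set D) := he ▸ Or.inr ha
      exact this
    have hsub : I.sem P ⊆ I.sem Q := by
      intro x hP
      by_contra hQ
      have hx : x ∈ ({d} : Set D) := he ▸ Or.inl fun h => h.elim (fun h => h hP) hQ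
      obtain rfl : x = d := hx
      exact hF.elim (fun h => h hP) hQ
    refine ⟨hsub, Set.Subset.antisymm ?_ (Set.singleton_subset_iff.2 ha)⟩
    exact he ▸ Set.subset_union_right
  · rintro ⟨hsub, ha⟩
    have hF : (I.sem P)ᶜ ∪ I.sem Q = Set.univ := by
      rwa [← Set.compl_subset_iff_union, compl_compl]
    simp [hF, ha]

/-- the ALCι_G concept
`C'' := C ⊓ ⨅_{(D,E)∈T} ((¬D ⊔ E) ⊓ A_{D⊑E} ⊓ (ι(¬(¬D ⊔ E) ⊔ A_{D⊑E}).⊤))`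
is satisfiable iff the ALC concept `C` is satisfiable w.r.t. the TBox `T`,
where the `A_{D⊑E}` are pairwise distinct fresh atomic concept names. -/
theorem stmt15 (A₀ : ℕ) (C : Concept) (T : Finset (Concept × Concept))
    (hC : C.isALC) (hT : ∀ p ∈ T, p.1.isALC ∧ p.2.isALC)
    (A : Concept × Concept → ℕ)
    (hinj : ∀ p ∈ T, ∀ q ∈ T, A p = A q → p = q)
    (hfreshC : ∀ p ∈ T, A p ∉ conceptNames C)
    (hfreshT : ∀ p ∈ T, ∀ q ∈ T, A p ∉ conceptNames q.1 ∪ conceptNames q.2)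
    (C'' : Concept)
    (hC'' : C'' = .conj C (bigConj (T.toList.map fun p =>
      .conj (.conj (disj (.neg p.1) p.2) (.atom (A p)))
        (.iotaG (disj (.neg (disj (.neg p.1) p.2)) (.atom (A p))) (top A₀))))) :
    (∃ (D : Type u) (_ : Nonempty D) (I : Interp D), (I.sem C'').Nonempty) ↔
    (∃ (D : Type u) (_ : Nonempty D) (I : Interp D),
      (I.sem C).Nonempty ∧ ∀ p ∈ T, I.sem p.1 ⊆ I.sem p.2) := by
  subst hC''
  have key {D : Type u} (I : Interp D) (d : D) :
      d ∈ I.sem (.conj C (bigConj (T.toList.map fun p =>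
        .conj (.conj (disj (.neg p.1) p.2) (.atom (A p)))
          (.iotaG (disj (.neg (disj (.neg p.1) p.2)) (.atom (A p))) (top A₀))))) ↔
        d ∈ I.sem C ∧ ∀ p ∈ T, I.sem p.1 ⊆ I.sem p.2 ∧ I.atomI (A p) = {d} := by
    rw [Interp.sem, Set.mem_inter_iff, Interp.mem_sem_bigConj, List.forall_mem_map]
    simp only [Interp.mem_sem_inclusion_iff, Finset.mem_toList]
  constructor
  · rintro ⟨D, hD, I, d, hd⟩
    obtain ⟨hdC, hdT⟩ := (key I d).1 hd
    exact ⟨D, hD, I, ⟨d, hdC⟩, fun p hp => (hdT p hp).1⟩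
  · rintro ⟨D, hD, I, ⟨d, hd⟩, hsub⟩
    classical
    let J : Interp D := ⟨fun a => if a ∈ T.image A then {d} else I.atomI a, I.roleI⟩
    have hJ (E : Concept) (hE : ∀ p ∈ T, A p ∉ conceptNames E) : J.sem E = I.sem E := by
      refine Interp.sem_congr (I := J) (J := I) rfl E fun a ha => if_neg fun haT => ?_
      obtain ⟨p, hp, rfl⟩ := Finset.mem_image.1 haT
      exact hE p hp ha
    refine ⟨D, hD, J, d, (key J d).2 ⟨hJ C hfreshC ▸ hd, fun p hp => ⟨?_, ?_⟩⟩⟩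
    · rw [hJ p.1 fun q hq h => hfreshT q hq p hp (Finset.mem_union_left _ h),
        hJ p.2 fun q hq h => hfreshT q hq p hp (Finset.mem_union_right _ h)]
      exact hsub p hp
    · exact if_pos (Finset.mem_image_of_mem A hp)

end DL
end
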